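/- arXiv:2006.03529 — 5 statements merged into one kernel-verified Lean document; each statement's English description precedes it below -/
import Mathlib

section
/- If H is an effectively 0D spin Hamiltonian, then its language L_H is a regular language. -/
/-- The finite alphabet of the language: Σ_q ∪ [p] ∪ auxiliary symbols. -/
inductive Symb (q p : ℕ) : Type where
  | spin (s : Fin q)      -- a spin symbol from Σ_q
  | ham (α : Fin p)       -- a local-Hamiltonian label from [p]
  | lhd                   -- ◁
  | rhd                   -- ▷
  | sq                    -- □
  | dia                   -- ◇
  | tri                   -- ▲
  | blank                 -- ␣
  | comp                  -- ∘
  | bullet                -- •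
  deriving DecidableEq, Fintype

/-- A local interaction `I = (α, A)`: a label `α ∈ [p]` together with a tuple of `k`
addresses, each an integer or the missing-spin symbol ▲ (modelled as `none`). -/
abbrev LocInt (k p : ℕ) := Fin p × (Fin k → Option ℤ)

/-- A configuration `(s_1, I_1, …, s_n, I_n)` (positions are 0-based here). -/
abbrev Config (q k p : ℕ) := List (Fin q × LocInt k p)

/-- The spin addressed by address `a` relative to (0-based) position `j`:
it is `▲` (`none`) whenever `a = ▲` or the addressed position lies outside `[n]`. -/
def spinAt {q k p : ℕ} (x : Config q k p) (j : ℕ) : Option ℤ → Option (Fin q)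
  | none => none
  | some l =>
      if 0 ≤ (j : ℤ) + l then (x[((j : ℤ) + l).toNat]?).map Prod.fst else none

/-- `H(s_1,I_1,…,s_n,I_n) = Σ_{j=1}^n h_{α_j}((s_{j+l})_{l ∈ A_j})`. -/
def energy {q k p : ℕ} (h : Fin p → (Fin k → Option (Fin q)) → ℤ)
    (x : Config q k p) : ℤ :=
  ∑ j : Fin x.length, h (x.get j).2.1 (fun l => spinAt x (j : ℕ) ((x.get j).2.2 l))

/-- The unary encoding `u : ℤ → {◇,□}*`. -/
def unary {q p : ℕ} (z : ℤ) : List (Symb q p) :=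
  if 0 ≤ z then List.replicate z.toNat Symb.dia else List.replicate (-z).toNat Symb.sq

/-- Encoding of an address: `u(a)` for an integer `a`, and `▲` for the missing-spin symbol. -/
def encAddr {q p : ℕ} : Option ℤ → List (Symb q p)
  | none => [Symb.tri]
  | some z => unary z

/-- `γ(α, (a_1,…,a_k)) = α ◁ u(a_1) ␣ ⋯ ␣ u(a_k) ▷`. -/
def encInt {q k p : ℕ} (I : LocInt k p) : List (Symb q p) :=
  [Symb.ham I.1, Symb.lhd] ++
    List.intercalate [Symb.blank] (List.ofFn fun l => encAddr (I.2 l)) ++ [Symb.rhd]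

/-- `e(s_1,I_1,…,s_n,I_n) = s_1 γ(I_1) ⋯ s_n γ(I_n)`. -/
def encConfig {q k p : ℕ} (x : Config q k p) : List (Symb q p) :=
  (x.map fun si => Symb.spin si.1 :: encInt si.2).flatten

/-- The language of the spin Hamiltonian, `L_H = { e(x) ∘ u(H(x)) • : x ∈ 𝒟 }`. -/
def langH {q k p : ℕ} (h : Fin p → (Fin k → Option (Fin q)) → ℤ)
    (D : Set (Config q k p)) : Language (Symb q p) :=
  {w | ∃ x ∈ D, w = encConfig x ++ [Symb.comp] ++ unary (energy h x) ++ [Symb.bullet]}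

/-- `𝓘_{1D} ⊆ [p] × {−k,…,k}^k` and nonempty: each address is an integer in `{−k,…,k}`. -/
def Is1DIntSet {k p : ℕ} (S : Set (LocInt k p)) : Prop :=
  S.Nonempty ∧ ∀ I ∈ S, ∀ l : Fin k, ∃ a : ℤ, I.2 l = some a ∧ -(k : ℤ) ≤ a ∧ a ≤ k

/-- The domain of a 1D spin Hamiltonian with constant interaction set `S = 𝓘_{1D}`:
all configurations of any length `n ≥ 1` with all local interactions drawn from `S`. -/
def Domain1D {k p : ℕ} (q : ℕ) (S : Set (LocInt k p)) : Set (Config q k p) :=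
  {x | x ≠ [] ∧ ∀ j : Fin x.length, (x.get j).2 ∈ S}

/-- If a word `w ++ v` is the image of `m` under letter-to-word substitution, then `m` can be cut
at the end of the letter in whose image `w` ends. -/
theorem exists_cut_of_append_eq_flatMap {α β : Type*} (f : α → List β) (m : List α) (w v : List β)
    (hwv : w ++ v = m.flatMap f) :
    ∃ u m' r, m = u ++ m' ∧ w ++ r = u.flatMap f ∧ v = r ++ m'.flatMap f ∧
      (r = [] ∨ ∃ a ∈ m, r <:+ f a) := by
  induction m generalizing w with
  | nil =>
    obtain ⟨rfl, rfl⟩ : w = [] ∧ v = [] := by simpa using hwv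
    exact ⟨[], [], [], by simp⟩
  | cons a m ih =>
    rw [List.flatMap_cons, List.append_eq_append_iff] at hwv
    rcases hwv with ⟨r, hr, hv⟩ | ⟨c, hc, hm⟩
    · exact ⟨[a], m, r, by simp, by simp [hr], hv, .inr ⟨a, by simp, w, hr.symm⟩⟩
    · obtain ⟨u, m', r, rfl, h2, h3, h4⟩ := ih c hm.symm
      refine ⟨a :: u, m', r, by simp, by simp [hc, h2], h3, ?_⟩
      rcases h4 with h4 | ⟨b, hb, hr⟩
      · exact .inl h4
      · exact .inr ⟨b, List.mem_cons_of_mem _ hb, hr⟩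

/-- The image of a language with finitely many left quotients under a letter-to-word substitution
is regular, provided only finitely many letters occur in the language. -/
theorem isRegular_flatMap_image {α β : Type*} (M : Language α) (f : α → List β) {F : Set α}
    (hF : F.Finite) (hM : ∀ m ∈ M, ∀ a ∈ m, a ∈ F) (hfin : (Set.range M.leftQuotient).Finite) :
    Language.IsRegular ({w | ∃ m ∈ M, w = m.flatMap f} : Language β) := by
  refine Language.IsRegular.of_finite_range_leftQuotient ?_
  set R : Set (List β) := {[]} ∪ ⋃ a ∈ F, {r | r <:+ f a}
  have hR : R.Finite := by
    refine (Set.finite_singleton _).union (hF.biUnion fun a _ => ?_)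
    refine ((f a).tails.finite_toSet).subset fun r hr => ?_
    simpa using hr
  let T : List β → Set (List β × Language α) := fun w =>
    {z | z.1 ∈ R ∧ ∃ u, w ++ z.1 = u.flatMap f ∧ z.2 = M.leftQuotient u}
  let G : Set (List β × Language α) → Language β := fun T =>
    {v | ∃ z ∈ T, ∃ m' ∈ z.2, v = z.1 ++ m'.flatMap f}
  refine ((hR.prod hfin).finite_subsets.image G).subset ?_
  rintro _ ⟨w, rfl⟩
  refine ⟨T w, ?_, ?_⟩
  · rintro ⟨r, Q⟩ ⟨hr, u, -, hQ⟩
    exact ⟨hr, u, hQ.symm⟩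
  · ext v
    change v ∈ G (T w) ↔ ∃ m ∈ M, w ++ v = m.flatMap f
    constructor
    · rintro ⟨⟨r, Q⟩, ⟨-, u, hu, hQ⟩, m', hm', hv⟩
      subst hQ hv
      exact ⟨u ++ m', hm', by rw [List.flatMap_append, ← hu, List.append_assoc]⟩
    · rintro ⟨m, hm, hwv⟩
      obtain ⟨u, m', r, rfl, h2, h3, h4⟩ := exists_cut_of_append_eq_flatMap f m w v hwv
      refine ⟨(r, M.leftQuotient u), ⟨?_, u, h2, rfl⟩, m', hm, h3⟩
      rcases h4 with h4 | ⟨a, ha, hr⟩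
      · exact .inl h4
      · exact .inr (Set.mem_biUnion (hM _ hm a ha) hr)

theorem Set.Finite.lists_length_le {α : Type*} {F : Set α} (hF : F.Finite) (n : ℕ) :
    {l : List α | (∀ a ∈ l, a ∈ F) ∧ l.length ≤ n}.Finite := by
  have := hF.to_subtype
  refine ((List.finite_length_le F n).image (List.map Subtype.val)).subset ?_
  rintro l ⟨hl, hn⟩
  lift l to List F using hl
  exact ⟨l, by simpa using hn, rfl⟩

/-- The local energy at position `j`, set to `0` outside the configuration. -/
def localEnergy {q k p : ℕ} (h : Fin p → (Fin k → Option (Fin q)) → ℤ)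
    (x : Config q k p) (j : ℕ) : ℤ :=
  (x[j]?).elim 0 fun si => h si.2.1 fun l => spinAt x j (si.2.2 l)

theorem energy_eq_sum_range {q k p : ℕ} (h : Fin p → (Fin k → Option (Fin q)) → ℤ)
    (x : Config q k p) : energy h x = ∑ j ∈ Finset.range x.length, localEnergy h x j := by
  rw [energy, ← Fin.sum_univ_eq_sum_range]
  simp [localEnergy]

/-- All addresses of all interactions in the configuration are integers in `{-k, …, k}`. -/
def HasRange {q k p : ℕ} (x : Config q k p) : Prop :=
  ∀ si ∈ x, ∀ l, ∃ a : ℤ, si.2.2 l = some a ∧ -(k : ℤ) ≤ a ∧ a ≤ k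

theorem localEnergy_append_left {q k p : ℕ} (h : Fin p → (Fin k → Option (Fin q)) → ℤ)
    {x : Config q k p} (hx : HasRange x) (y : Config q k p) {j : ℕ} (hj : j + k < x.length) :
    localEnergy h (x ++ y) j = localEnergy h x j := by
  have hj' : j < x.length := by omega
  simp only [localEnergy, List.getElem?_append_left hj', List.getElem?_eq_getElem hj',
    Option.elim_some]
  congr 1
  funext l
  obtain ⟨a, ha, h1, h2⟩ := hx _ (List.getElem_mem hj') l
  simp only [ha, spinAt]
  rw [List.getElem?_append_left (by omega)]

theorem localEnergy_append_right {q k p : ℕ} (h : Fin p → (Fin k → Option (Fin q)) → ℤ)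
    (a : Config q k p) {x : Config q k p} (hx : HasRange x) {j : ℕ} (hj : k ≤ j) :
    localEnergy h (a ++ x) (a.length + j) = localEnergy h x j := by
  rw [localEnergy, localEnergy, List.getElem?_append_right (by omega), Nat.add_sub_cancel_left]
  cases hxj : x[j]? with
  | none => rfl
  | some si =>
    simp only [Option.elim_some]
    congr 1
    funext l
    obtain ⟨b, hb, h1, h2⟩ := hx _ (List.mem_of_getElem? hxj) l
    simp only [hb, spinAt]
    rw [if_pos (by omega), if_pos (by omega), List.getElem?_append_right (by omega)]
    congr 2
    omega

/-- Across a window `b` of twice the interaction range, the energy is additive. -/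
theorem energy_append_append {q k p : ℕ} (h : Fin p → (Fin k → Option (Fin q)) → ℤ)
    {a b y : Config q k p} (ha : HasRange a) (hb : HasRange b) (hy : HasRange y)
    (hlen : b.length = k + k) :
    energy h (a ++ (b ++ y)) + energy h b = energy h (a ++ b) + energy h (b ++ y) := by
  have hab : HasRange (a ++ b) := fun si hsi => (List.mem_append.1 hsi).elim (ha si) (hb si)
  have hby : HasRange (b ++ y) := fun si hsi => (List.mem_append.1 hsi).elim (hb si) (hy si)
  have e1 : (a ++ (b ++ y)).length = (a.length + k) + (k + y.length) := by
    simp only [List.length_append]; omega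
  have e2 : (a ++ b).length = (a.length + k) + k := by simp only [List.length_append]; omega
  have e3 : (b ++ y).length = k + (k + y.length) := by simp only [List.length_append]; omega
  simp only [energy_eq_sum_range, e1, e2, e3, hlen]
  rw [Finset.sum_range_add _ (a.length + k) (k + y.length),
    Finset.sum_range_add _ (a.length + k) k, Finset.sum_range_add _ k (k + y.length),
    Finset.sum_range_add _ k k]
  have s1 : ∀ j ∈ Finset.range (a.length + k),
      localEnergy h (a ++ (b ++ y)) j = localEnergy h (a ++ b) j := by
    intro j hj
    rw [Finset.mem_range] at hj
    rw [← List.append_assoc]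
    exact localEnergy_append_left h hab y (by omega)
  have s2 : ∀ j ∈ Finset.range (k + y.length),
      localEnergy h (a ++ (b ++ y)) (a.length + k + j) = localEnergy h (b ++ y) (k + j) := by
    intro j _
    rw [add_assoc]
    exact localEnergy_append_right h a hby (by omega)
  have s3 : ∀ j ∈ Finset.range k,
      localEnergy h (a ++ b) (a.length + k + j) = localEnergy h b (k + j) := by
    intro j _
    rw [add_assoc]
    exact localEnergy_append_right h a hb (by omega)
  have s4 : ∀ j ∈ Finset.range k, localEnergy h (b ++ y) j = localEnergy h b j := by
    intro j hj
    rw [Finset.mem_range] at hj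
    exact localEnergy_append_left h hb y (by omega)
  rw [Finset.sum_congr rfl s1, Finset.sum_congr rfl s2, Finset.sum_congr rfl s3,
    Finset.sum_congr rfl s4]
  ring

theorem mem_domain1D {q k p : ℕ} {S : Set (LocInt k p)} {x : Config q k p} :
    x ∈ Domain1D q S ↔ x ≠ [] ∧ ∀ si ∈ x, si.2 ∈ S := by
  simp only [Domain1D, Set.mem_ofPred_eq, List.forall_mem_iff_get]

theorem Is1DIntSet.hasRange {q k p : ℕ} {S : Set (LocInt k p)} (hS : Is1DIntSet S)
    {x : Config q k p} (hx : ∀ si ∈ x, si.2 ∈ S) : HasRange x :=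
  fun si hsi l => hS.2 _ (hx si hsi) l

theorem Is1DIntSet.finite {k p : ℕ} {S : Set (LocInt k p)} (hS : Is1DIntSet S) : S.Finite := by
  have h1 : (Set.univ.pi fun _ : Fin k => some '' Set.Icc (-(k : ℤ)) k).Finite :=
    Set.Finite.pi fun _ => (Set.finite_Icc _ _).image _
  refine ((Set.finite_univ (α := Fin p)).prod h1).subset fun I hI => ⟨trivial, fun l _ => ?_⟩
  obtain ⟨a, ha, h1, h2⟩ := hS.2 I hI l
  exact ⟨a, ⟨h1, h2⟩, ha.symm⟩

/-- The language of configurations over the alphabet of sites, each followed by its energy as a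
single letter. -/
def siteLang {q k p : ℕ} (h : Fin p → (Fin k → Option (Fin q)) → ℤ)
    (D : Set (Config q k p)) : Language ((Fin q × LocInt k p) ⊕ ℤ) :=
  {w | ∃ x ∈ D, w = x.map Sum.inl ++ [Sum.inr (energy h x)]}

/-- The encoding of a site or of a final energy. -/
def encLetter {q k p : ℕ} : (Fin q × LocInt k p) ⊕ ℤ → List (Symb q p)
  | .inl si => Symb.spin si.1 :: encInt si.2
  | .inr e => Symb.comp :: (unary e ++ [Symb.bullet])

theorem langH_eq_flatMap_siteLang {q k p : ℕ} (h : Fin p → (Fin k → Option (Fin q)) → ℤ)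
    (D : Set (Config q k p)) :
    langH h D = {w | ∃ m ∈ siteLang h D, w = m.flatMap encLetter} := by
  have key (x : Config q k p) :
      (x.map Sum.inl ++ [Sum.inr (energy h x)]).flatMap encLetter =
        encConfig x ++ [Symb.comp] ++ unary (energy h x) ++ [Symb.bullet] := by
    simp [encConfig, encLetter, List.flatMap_def, Function.comp_def]
  ext w
  constructor
  · rintro ⟨x, hx, hw⟩
    exact ⟨_, ⟨x, hx, rfl⟩, by rw [key, hw]⟩
  · rintro ⟨_, ⟨x, hx, rfl⟩, hw⟩
    exact ⟨x, hx, by rw [hw, key]⟩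

/-- In a one-dimensional system, the last `2k` sites of a configuration determine how its energy
changes under appending further sites. -/
theorem exists_window {q k p : ℕ} (h : Fin p → (Fin k → Option (Fin q)) → ℤ)
    (hk : 0 < k) {S : Set (LocInt k p)} (hS : Is1DIntSet S) {x : Config q k p}
    (hx : ∀ si ∈ x, si.2 ∈ S) :
    ∃ b : Config q k p, (∀ si ∈ b, si.2 ∈ S) ∧ b.length ≤ k + k ∧ (b = [] ↔ x = []) ∧
      ∀ y : Config q k p, (∀ si ∈ y, si.2 ∈ S) →
        energy h (x ++ y) = energy h x - energy h b + energy h (b ++ y) := by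
  rcases le_or_gt x.length (k + k) with hlen | hlen
  · exact ⟨x, hx, hlen, Iff.rfl, fun y _ => by ring⟩
  · obtain ⟨a, b, rfl, hb⟩ : ∃ a b, x = a ++ b ∧ b.length = k + k :=
      ⟨x.take (x.length - (k + k)), x.drop (x.length - (k + k)), by simp, by
        rw [List.length_drop]; omega⟩
    have ha' : ∀ si ∈ a, si.2 ∈ S := fun si hsi => hx si (List.mem_append_left _ hsi)
    have hb' : ∀ si ∈ b, si.2 ∈ S := fun si hsi => hx si (List.mem_append_right _ hsi)
    have hb0 : b ≠ [] := by rintro rfl; simp at hb; omega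
    refine ⟨b, hb', hb.le, by simp [hb0], fun y hy => ?_⟩
    have := energy_append_append h (hS.hasRange ha') (hS.hasRange hb') (hS.hasRange hy) hb
    rw [List.append_assoc]
    linarith

theorem finite_range_leftQuotient_siteLang {q k p : ℕ} (hk : 0 < k)
    (h : Fin p → (Fin k → Option (Fin q)) → ℤ) {S : Set (LocInt k p)} (hS : Is1DIntSet S)
    {B : ℤ} (hB : ∀ x ∈ Domain1D q S, |energy h x| ≤ B) :
    (Set.range (siteLang h (Domain1D q S)).leftQuotient).Finite := by
  set E : Set ℤ := {0} ∪ Set.Icc (-B) B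
  have hE : E.Finite := (Set.finite_singleton _).union (Set.finite_Icc _ _)
  set W : Set (Config q k p) :=
    {b | (∀ si ∈ b, si ∈ (Set.univ ×ˢ S : Set (Fin q × LocInt k p))) ∧ b.length ≤ k + k}
  have hW : W.Finite := (Set.finite_univ.prod hS.finite).lists_length_le _
  let G : ℤ × Config q k p → Language ((Fin q × LocInt k p) ⊕ ℤ) := fun z =>
    {v | ∃ y : Config q k p, z.2 ++ y ∈ Domain1D q S ∧
      v = y.map Sum.inl ++ [Sum.inr (z.1 - energy h z.2 + energy h (z.2 ++ y))]}
  have hsing : {Q : Language ((Fin q × LocInt k p) ⊕ ℤ) | ∀ v ∈ Q, v = []}.Finite :=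
    (Set.finite_singleton []).finite_subsets
  refine (hsing.union ((hE.prod hW).image G)).subset ?_
  rintro _ ⟨w, rfl⟩
  by_cases hw : ∃ x : Config q k p, w = x.map Sum.inl ∧ ∀ si ∈ x, si.2 ∈ S
  · obtain ⟨x, rfl, hx⟩ := hw
    obtain ⟨b, hbS, hblen, hb0, hbe⟩ := exists_window h hk hS hx
    refine .inr ⟨(energy h x, b), ⟨?_, fun si hsi => ⟨trivial, hbS si hsi⟩, hblen⟩, ?_⟩
    · by_cases hx0 : x = []
      · subst hx0; exact .inl (by simp [energy])
      · exact .inr (abs_le.1 (hB x (mem_domain1D.2 ⟨hx0, hx⟩)))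
    · have hdom (y : Config q k p) : b ++ y ∈ Domain1D q S ↔ x ++ y ∈ Domain1D q S := by
        simp only [mem_domain1D, ne_eq, List.append_eq_nil_iff, hb0, List.forall_mem_append]
        tauto
      have hyS {y : Config q k p} (hy : x ++ y ∈ Domain1D q S) : ∀ si ∈ y, si.2 ∈ S :=
        fun si hsi => (mem_domain1D.1 hy).2 si (List.mem_append_right _ hsi)
      ext v
      rw [Language.mem_leftQuotient]
      constructor
      · rintro ⟨y, hy, rfl⟩
        have hy' := (hdom y).1 hy
        exact ⟨x ++ y, hy', by simp [hbe y (hyS hy')]⟩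
      · rintro ⟨x', hx', hv⟩
        rcases List.append_eq_append_iff.1 hv with ⟨c, hc, hv'⟩ | ⟨c, hc, hv'⟩
        · obtain ⟨x₁, y, rfl, h1, rfl⟩ := List.map_eq_append_iff.1 hc
          obtain rfl := List.map_injective_iff.2 Sum.inl_injective h1
          exact ⟨y, (hdom y).2 hx', by rw [hv', hbe y (hyS hx')]⟩
        · rcases c with _ | ⟨c, cs⟩
          · simp only [List.append_nil, List.nil_append] at hc hv'
            obtain rfl := List.map_injective_iff.2 Sum.inl_injective hc
            refine ⟨[], (hdom []).2 (by simpa using hx'), ?_⟩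
            simp [← hv']
          · have hmem : Sum.inr (energy h x') ∈ x.map Sum.inl := by
              rw [hc]
              simp only [List.cons_append, List.cons.injEq] at hv'
              simp [← hv'.1]
            simp at hmem
  · refine .inl fun v hv => ?_
    obtain ⟨x, hx, hv⟩ := hv
    by_contra hv0
    obtain ⟨v', c, rfl⟩ := (List.eq_nil_or_concat' v).resolve_left hv0
    rw [← List.append_assoc] at hv
    obtain ⟨x₁, y, rfl, h1, -⟩ := List.map_eq_append_iff.1 (List.append_inj_left' hv rfl).symm
    exact hw ⟨x₁, h1.symm, fun si hsi =>
      (mem_domain1D.1 hx).2 si (List.mem_append_left _ hsi)⟩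

/-- If `H` is an effectively 0D spin Hamiltonian (a 1D spin Hamiltonian
with bounded image), then its language `L_H` is regular. -/
theorem eff0D_regular {q k p : ℕ} (hq : 0 < q) (hk : 0 < k) (hp : 0 < p)
    (h : Fin p → (Fin k → Option (Fin q)) → ℤ)
    (S : Set (LocInt k p)) (hS : Is1DIntSet S)
    (hbdd : ∃ B : ℤ, ∀ x ∈ Domain1D q S, |energy h x| ≤ B) :
    (langH h (Domain1D q S)).IsRegular := by
  obtain ⟨B, hB⟩ := hbdd
  rw [langH_eq_flatMap_siteLang]
  refine isRegular_flatMap_image _ _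
    (((Set.finite_univ.prod hS.finite).image Sum.inl).union
      ((Set.finite_Icc (-B) B).image Sum.inr)) ?_
    (finite_range_leftQuotient_siteLang hk h hS hB)
  rintro _ ⟨x, hx, rfl⟩ a ha
  rcases List.mem_append.1 ha with ha | ha
  · obtain ⟨si, hsi, rfl⟩ := List.mem_map.1 ha
    exact .inl ⟨si, ⟨trivial, (mem_domain1D.1 hx).2 si hsi⟩, rfl⟩
  · obtain rfl := List.mem_singleton.1 ha
    exact .inr ⟨_, abs_le.1 (hB x hx), rfl⟩
end

section
/- If H is a 1D spin Hamiltonian whose image H(𝒟) is an unbounded subset of ℤ (i.e., H is not effectively 0D), then its language L_H is not a regular language. -/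
theorem unary_eq_replicate {q p : ℕ} (z : ℤ) :
    (unary z : List (Symb q p)) =
      List.replicate z.natAbs (if 0 ≤ z then Symb.dia else Symb.sq) := by
  unfold unary
  split_ifs <;> congr 1 <;> omega

theorem length_unary {q p : ℕ} (z : ℤ) : (unary z : List (Symb q p)).length = z.natAbs := by
  simp [unary_eq_replicate]

theorem eq_dia_or_eq_sq_of_mem_unary {q p : ℕ} {z : ℤ} {a : Symb q p} (ha : a ∈ unary z) :
    a = Symb.dia ∨ a = Symb.sq := by
  rw [unary_eq_replicate] at ha
  have := List.eq_of_mem_replicate ha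
  split_ifs at this <;> simp [this]

theorem unary_injective {q p : ℕ} : Function.Injective (unary : ℤ → List (Symb q p)) := by
  intro z w hzw
  have hlen := congrArg List.length hzw
  rw [length_unary, length_unary] at hlen
  by_contra hne
  rw [unary_eq_replicate, unary_eq_replicate, hlen, List.replicate_inj] at hzw
  rcases hzw.2 with h0 | h0
  · omega
  · split_ifs at h0 <;> omega

theorem mem_encAddr {q p : ℕ} {o : Option ℤ} {a : Symb q p} (ha : a ∈ encAddr o) :
    a = Symb.dia ∨ a = Symb.sq ∨ a = Symb.tri := by
  cases o with
  | none => simpa [encAddr] using Or.inr (Or.inr (List.mem_singleton.1 ha))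
  | some z => rcases eq_dia_or_eq_sq_of_mem_unary ha with h | h <;> simp [h]

theorem encAddr_injective {q p : ℕ} :
    Function.Injective (encAddr : Option ℤ → List (Symb q p)) := by
  have tri_ne (z : ℤ) : ([Symb.tri] : List (Symb q p)) ≠ unary z := fun h => by
    have := eq_dia_or_eq_sq_of_mem_unary (h ▸ List.mem_singleton_self _)
    simp at this
  rintro (_ | z) (_ | w) h
  · rfl
  · exact absurd h (tri_ne w)
  · exact absurd h.symm (tri_ne z)
  · exact congrArg some (unary_injective h)

/-- The symbols between the brackets of an encoded local interaction. -/
def encAddrs {q k p : ℕ} (A : Fin k → Option ℤ) : List (Symb q p) :=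
  List.intercalate [Symb.blank] (List.ofFn fun l => encAddr (A l))

theorem List.mem_of_mem_intercalate {α : Type*} {s : List α} {ls : List (List α)} {a : α}
    (ha : a ∈ List.intercalate s ls) : a ∈ s ∨ ∃ l ∈ ls, a ∈ l := by
  induction ls with
  | nil => simp at ha
  | cons b ls ih =>
    cases ls with
    | nil => exact Or.inr ⟨b, by simp, by simpa using ha⟩
    | cons c ls =>
      rw [List.intercalate_cons_cons] at ha
      simp only [List.mem_append, List.mem_cons] at ha ih ⊢
      grind

theorem mem_encAddrs {q k p : ℕ} {A : Fin k → Option ℤ} {a : Symb q p} (ha : a ∈ encAddrs A) :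
    a = Symb.blank ∨ a = Symb.dia ∨ a = Symb.sq ∨ a = Symb.tri := by
  rcases List.mem_of_mem_intercalate ha with h | ⟨l, hl, h⟩
  · exact Or.inl (List.mem_singleton.1 h)
  · obtain ⟨i, rfl⟩ := (List.mem_ofFn' _ _).1 hl
    exact Or.inr (mem_encAddr h)

theorem encAddrs_injective {q k p : ℕ} (hk : 0 < k) :
    Function.Injective (encAddrs : (Fin k → Option ℤ) → List (Symb q p)) := by
  have split (A : Fin k → Option ℤ) : (encAddrs A : List (Symb q p)).splitOn Symb.blank =
      List.ofFn fun l => encAddr (A l) := by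
    refine List.splitOn_intercalate _ ?_ ?_
    · intro l hl hmem
      obtain ⟨i, rfl⟩ := (List.mem_ofFn' _ _).1 hl
      simpa using mem_encAddr hmem
    · simpa [List.ofFn_eq_nil_iff] using hk.ne'
  intro A B hAB
  have h := split A
  rw [hAB, split B] at h
  exact funext fun l => (encAddr_injective (congrFun (List.ofFn_injective h) l)).symm

theorem encInt_eq {q k p : ℕ} (I : LocInt k p) :
    (encInt I : List (Symb q p)) =
      Symb.ham I.1 :: Symb.lhd :: (encAddrs I.2 ++ [Symb.rhd]) := rfl

theorem rhd_notMem_encAddrs {q k p : ℕ} (A : Fin k → Option ℤ) :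
    (Symb.rhd : Symb q p) ∉ encAddrs A := fun h => by simpa using mem_encAddrs h

theorem List.append_cons_inj_of_notMem_left {α : Type*} {a : α} {u u' v v' : List α}
    (hu : a ∉ u) (hu' : a ∉ u') : u ++ a :: v = u' ++ a :: v' ↔ u = u' ∧ v = v' := by
  refine ⟨fun h => ?_, by rintro ⟨rfl, rfl⟩; rfl⟩
  induction u generalizing u' with
  | nil =>
    cases u' with
    | nil => simpa using h
    | cons c u' => exact absurd (List.cons.inj h).1 (List.ne_of_not_mem_cons hu')
  | cons b u ih =>
    cases u' with
    | nil => exact absurd (List.cons.inj h).1.symm (List.ne_of_not_mem_cons hu)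
    | cons c u' =>
      simp only [List.mem_cons, not_or, List.cons_append, List.cons.injEq] at hu hu' h ⊢
      exact ⟨⟨h.1, (ih hu.2 hu'.2 h.2).1⟩, (ih hu.2 hu'.2 h.2).2⟩

theorem encConfig_cons {q k p : ℕ} (si : Fin q × LocInt k p) (x : Config q k p) :
    encConfig (si :: x) =
      Symb.spin si.1 :: Symb.ham si.2.1 :: Symb.lhd ::
        (encAddrs si.2.2 ++ Symb.rhd :: encConfig x) := by
  simp only [encConfig, List.map_cons, List.flatten_cons, encInt_eq, List.cons_append,
    List.append_assoc, List.nil_append]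

theorem encConfig_injective {q k p : ℕ} (hk : 0 < k) :
    Function.Injective (encConfig : Config q k p → List (Symb q p)) := by
  intro x
  induction x with
  | nil =>
    rintro (_ | ⟨b, y⟩) h
    · rfl
    · rw [encConfig_cons] at h
      simp [encConfig] at h
  | cons a x ih =>
    rintro (_ | ⟨b, y⟩) h
    · rw [encConfig_cons] at h
      simp [encConfig] at h
    · simp only [encConfig_cons, List.cons.injEq, Symb.spin.injEq, Symb.ham.injEq, true_and] at h
      obtain ⟨hs, hα, h⟩ := h
      obtain ⟨hA, h⟩ := (List.append_cons_inj_of_notMem_left (rhd_notMem_encAddrs _)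
        (rhd_notMem_encAddrs _)).1 h
      rw [ih h, Prod.ext hs (Prod.ext hα (encAddrs_injective hk hA))]

theorem comp_notMem_encConfig {q k p : ℕ} (x : Config q k p) :
    (Symb.comp : Symb q p) ∉ encConfig x := by
  induction x with
  | nil => simp [encConfig]
  | cons a x ih =>
    have : (Symb.comp : Symb q p) ∉ encAddrs a.2.2 := fun h => by simpa using mem_encAddrs h
    simp [encConfig_cons, this, ih]

/-- A run of equal symbols at least as long as the number of states of a DFA can be lengthened
without changing the state reached. -/
theorem DFA.exists_evalFrom_replicate_add {α σ : Type*} [Fintype σ] (M : DFA α σ) (s : σ) (a : α)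
    {m : ℕ} (hm : Fintype.card σ ≤ m) :
    ∃ d, 0 < d ∧ M.evalFrom s (List.replicate (m + d) a) = M.evalFrom s (List.replicate m a) := by
  obtain ⟨t, u, v, w, huvw, -, hv, hu, hvt, hw⟩ :=
    M.evalFrom_split (x := List.replicate m a) (s := s) (by simpa using hm) rfl
  refine ⟨v.length, List.length_pos_iff.2 hv, ?_⟩
  have hmem : ∀ b ∈ u ++ v ++ w, b = a := fun b hb =>
    List.eq_of_mem_replicate (huvw ▸ hb)
  have hpump : List.replicate (m + v.length) a = u ++ v ++ v ++ w := by
    refine (List.eq_replicate_iff.2 ⟨?_, fun b hb => hmem b ?_⟩).symm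
    · have := congrArg List.length huvw
      simp at this ⊢
      omega
    · simp at hb ⊢
      tauto
  rw [hpump, ← hw]
  simp only [DFA.evalFrom_of_append, hu, hvt]

/-- If `H` is a 1D spin Hamiltonian with unbounded image (i.e. `H` is
not effectively 0D), then its language `L_H` is not regular. -/
theorem oneD_not_regular {q k p : ℕ} (hq : 0 < q) (hk : 0 < k) (hp : 0 < p)
    (h : Fin p → (Fin k → Option (Fin q)) → ℤ)
    (S : Set (LocInt k p)) (hS : Is1DIntSet S)
    (hunbdd : ¬ ∃ B : ℤ, ∀ x ∈ Domain1D q S, |energy h x| ≤ B) :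
    ¬ (langH h (Domain1D q S)).IsRegular := by
  rintro ⟨σ, _, M, hM⟩
  push Not at hunbdd
  obtain ⟨x, hx, hlarge⟩ := hunbdd (Fintype.card σ)
  obtain ⟨d, hd, hpump⟩ := M.exists_evalFrom_replicate_add
    (M.eval (encConfig x ++ [Symb.comp])) (if 0 ≤ energy h x then Symb.dia else Symb.sq)
    (m := (energy h x).natAbs) (by rw [Int.abs_eq_natAbs] at hlarge; omega)
  have hmem : encConfig x ++ [Symb.comp] ++ unary (energy h x) ++ [Symb.bullet] ∈ M.accepts :=
    hM ▸ ⟨x, hx, rfl⟩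
  rw [DFA.mem_accepts, DFA.eval, DFA.evalFrom_of_append, DFA.evalFrom_of_append,
    unary_eq_replicate, ← DFA.eval, ← hpump, DFA.eval, ← DFA.evalFrom_of_append,
    ← DFA.evalFrom_of_append, ← DFA.eval, ← DFA.mem_accepts, hM] at hmem
  obtain ⟨y, -, hy⟩ := hmem
  simp only [List.append_assoc, List.singleton_append] at hy
  obtain ⟨hxy, htail⟩ := (List.append_cons_inj_of_notMem_left (comp_notMem_encConfig _)
    (comp_notMem_encConfig _)).1 hy
  obtain rfl := encConfig_injective hk hxy
  have hlen := congrArg List.length htail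
  simp only [List.append_eq, List.length_append, List.length_replicate,
    length_unary] at hlen
  omega
end

section
/- If H is a dD spin Hamiltonian with d ≥ 2, then its language L_H is not a context-free language. -/
/-- `N_i = n_1 ⋯ n_i` (and `N_0 = 1`), where `nn` lists the side lengths (0-based). -/
def Npart {d : ℕ} (nn : Fin d → ℕ) (i : Fin d) : ℕ := ∏ t ∈ Finset.Iio i, nn t

/-- The `i`-th coordinate `a_i` in the decomposition `j = Σ_i a_i N_i` (`j` 0-based). -/
def coordOf {d : ℕ} (nn : Fin d → ℕ) (j : ℕ) (i : Fin d) : ℕ :=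
  (j / Npart nn i) % nn i

/-- `Z_{n,j}(v) = Σ_i v_i N_i` if `0 ≤ a_i + v_i < n_{i+1}` for all `i`, and ▲ otherwise. -/
def Zfun {d : ℕ} (nn : Fin d → ℕ) (j : ℕ) (v : Fin d → ℤ) : Option ℤ :=
  if ∀ i, 0 ≤ (coordOf nn j i : ℤ) + v i ∧ (coordOf nn j i : ℤ) + v i < (nn i : ℤ)
  then some (∑ i, v i * (Npart nn i : ℤ)) else none

/-- The domain of a dD spin Hamiltonian with base lattice `ℓ` and move set `V`:
configurations whose length is `∏ i (m ℓ_i)` for some `m ≥ 1`, with each local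
interaction of the form `(α, (Z_{n,j}(v^1),…,Z_{n,j}(v^k)))` for some `(α, vs) ∈ V`. -/
def DomainDD {q k p : ℕ} (d : ℕ) (ℓ : Fin d → ℕ)
    (V : Set (Fin p × (Fin k → Fin d → ℤ))) : Set (Config q k p) :=
  {x | ∃ m : ℕ, 1 ≤ m ∧ x.length = ∏ i, m * ℓ i ∧
      ∀ j : Fin x.length, ∃ αv ∈ V,
        (x.get j).2 = (αv.1, fun l => Zfun (fun i => m * ℓ i) (j : ℕ) (αv.2 l))}

namespace ContextFreeGrammar

variable {T : Type*}

/-- `g.HasYield P α n s` holds if some forest of parse trees of `g` with `s` inner nodes has roots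
`α` and a yield containing exactly `n` terminals that satisfy `P`. -/
inductive HasYield (g : ContextFreeGrammar T) (P : T → Bool) :
    List (Symbol T g.NT) → ℕ → ℕ → Prop
  | nil : HasYield g P [] 0 0
  | terminal (t : T) {α : List (Symbol T g.NT)} {n s : ℕ} :
      HasYield g P α n s →
      HasYield g P (Symbol.terminal t :: α) ((if P t then 1 else 0) + n) s
  | nonterminal {r : ContextFreeRule T g.NT} (hr : r ∈ g.rules) {α : List (Symbol T g.NT)}
      {m n s₁ s₂ : ℕ} :
      HasYield g P r.output m s₁ → HasYield g P α n s₂ →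
      HasYield g P (Symbol.nonterminal r.input :: α) (m + n) (s₁ + s₂ + 1)

/-- Replacing a suitable leaf of a forest with roots `α` by any parse tree with root `B` gives
a forest with roots `α` and `c` further marked terminals. -/
def HasContext (g : ContextFreeGrammar T) (P : T → Bool) (α : List (Symbol T g.NT)) (B : g.NT)
    (c : ℕ) : Prop :=
  ∀ n s, g.HasYield P [Symbol.nonterminal B] n s → ∃ s', g.HasYield P α (c + n) s'

variable {g : ContextFreeGrammar T} {P : T → Bool}

lemma HasYield.append {α β : List (Symbol T g.NT)} {m n s₁ s₂ : ℕ}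
    (hα : g.HasYield P α m s₁) (hβ : g.HasYield P β n s₂) :
    ∃ s, g.HasYield P (α ++ β) (m + n) s := by
  induction hα with
  | nil => exact ⟨s₂, by simpa using hβ⟩
  | terminal t _ ih =>
    obtain ⟨s, hs⟩ := ih
    exact ⟨s, by simpa [add_assoc] using hs.terminal t⟩
  | nonterminal hr ho _ _ ih =>
    obtain ⟨s, hs⟩ := ih
    exact ⟨_, by simpa [add_assoc] using HasYield.nonterminal hr ho hs⟩

lemma HasYield.of_append {α β : List (Symbol T g.NT)} {n s : ℕ}
    (h : g.HasYield P (α ++ β) n s) :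
    ∃ n₁ n₂ s₁ s₂, n = n₁ + n₂ ∧ g.HasYield P α n₁ s₁ ∧ g.HasYield P β n₂ s₂ := by
  induction α generalizing n s with
  | nil => exact ⟨0, n, 0, s, by simp, .nil, h⟩
  | cons a α ih =>
    cases h with
    | terminal t h =>
      obtain ⟨n₁, n₂, s₁, s₂, rfl, h₁, h₂⟩ := ih h
      exact ⟨_, n₂, _, s₂, (add_assoc _ _ _).symm, h₁.terminal t, h₂⟩
    | nonterminal hr ho h =>
      obtain ⟨n₁, n₂, s₁, s₂, rfl, h₁, h₂⟩ := ih h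
      exact ⟨_, n₂, _, s₂, (add_assoc _ _ _).symm, .nonterminal hr ho h₁, h₂⟩

lemma HasYield.of_singleton {A : g.NT} {n s : ℕ}
    (h : g.HasYield P [Symbol.nonterminal A] n s) :
    ∃ r ∈ g.rules, r.input = A ∧ ∃ s' < s, g.HasYield P r.output n s' := by
  cases h with
  | @nonterminal r hr _ m n s₁ s₂ ho h =>
    cases h
    exact ⟨r, hr, rfl, s₁, by omega, ho⟩

lemma HasYield.singleton {r : ContextFreeRule T g.NT} (hr : r ∈ g.rules) {n s : ℕ}
    (h : g.HasYield P r.output n s) :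
    g.HasYield P [Symbol.nonterminal r.input] n (s + 1) :=
  HasYield.nonterminal hr h .nil

lemma HasYield.exists_derives {α : List (Symbol T g.NT)} {n s : ℕ} (h : g.HasYield P α n s) :
    ∃ w : List T, g.Derives α (w.map Symbol.terminal) ∧ w.countP P = n := by
  induction h with
  | nil => exact ⟨[], Derives.refl _, rfl⟩
  | terminal t _ ih =>
    obtain ⟨w, hw, rfl⟩ := ih
    refine ⟨t :: w, by simpa using hw.append_left [Symbol.terminal t], ?_⟩
    rw [List.countP_cons, add_comm]
  | @nonterminal r hr α _ _ _ _ _ _ ih₁ ih₂ =>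
    obtain ⟨w₁, h₁, rfl⟩ := ih₁
    obtain ⟨w₂, h₂, rfl⟩ := ih₂
    refine ⟨w₁ ++ w₂, ?_, List.countP_append⟩
    have hstep : g.Produces (Symbol.nonterminal r.input :: α) (r.output ++ α) :=
      ⟨r, hr, ContextFreeRule.Rewrites.head α⟩
    rw [List.map_append]
    exact hstep.trans_derives ((h₁.append_right α).trans (h₂.append_left _))

lemma hasYield_map_terminal (g : ContextFreeGrammar T) (P : T → Bool) (w : List T) :
    g.HasYield P (w.map Symbol.terminal) (w.countP P) 0 := by
  induction w with
  | nil => exact .nil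
  | cons t w ih =>
    rw [List.countP_cons, add_comm]
    exact ih.terminal t

lemma Derives.exists_hasYield {α : List (Symbol T g.NT)} {w : List T}
    (h : g.Derives α (w.map Symbol.terminal)) : ∃ s, g.HasYield P α (w.countP P) s := by
  induction h using Relation.ReflTransGen.head_induction_on with
  | refl => exact ⟨0, g.hasYield_map_terminal P w⟩
  | head hstep _ ih =>
    obtain ⟨s, hs⟩ := ih
    obtain ⟨r, hr, hrw⟩ := hstep
    obtain ⟨p, q, rfl, rfl⟩ := hrw.exists_parts
    obtain ⟨n₁, n₂, s₁, s₂, hn, h₁, h₂⟩ := hs.of_append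
    obtain ⟨m₁, m₂, t₁, t₂, rfl, h₃, h₄⟩ := h₁.of_append
    obtain ⟨_, h₅⟩ := h₃.append (HasYield.singleton hr h₄)
    rw [hn]
    exact h₅.append h₂

lemma HasContext.trans {α : List (Symbol T g.NT)} {A B : g.NT} {c c' : ℕ}
    (h : g.HasContext P α A c) (h' : g.HasContext P [Symbol.nonterminal A] B c') :
    g.HasContext P α B (c + c') := by
  intro n s hn
  obtain ⟨s', hs'⟩ := h' n s hn
  obtain ⟨s'', hs''⟩ := h _ s' hs'
  exact ⟨s'', by rwa [add_assoc]⟩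

lemma HasContext.refl (A : g.NT) : g.HasContext P [Symbol.nonterminal A] A 0 :=
  fun n s hn => ⟨s, by rwa [zero_add]⟩

lemma HasContext.iterate {A : g.NT} {c : ℕ}
    (h : g.HasContext P [Symbol.nonterminal A] A c) (i : ℕ) :
    g.HasContext P [Symbol.nonterminal A] A (i * c) := by
  induction i with
  | zero => simpa using HasContext.refl A
  | succ i ih => simpa [add_mul] using ih.trans h

lemma HasContext.of_output {r : ContextFreeRule T g.NT} (hr : r ∈ g.rules) {B : g.NT} {c : ℕ}
    (h : g.HasContext P r.output B c) :
    g.HasContext P [Symbol.nonterminal r.input] B c := by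
  intro n s hn
  obtain ⟨s', hs'⟩ := h n s hn
  exact ⟨_, HasYield.singleton hr hs'⟩

/-- A forest with many marked terminals has a tree with many marked terminals. -/
lemma HasYield.exists_heavy_root {α : List (Symbol T g.NT)} {n s K : ℕ} (hK : 1 ≤ K)
    (h : g.HasYield P α n s) (hn : α.length * K < n) :
    ∃ B m c s', s' ≤ s ∧ K < m ∧ c + m = n ∧ g.HasYield P [Symbol.nonterminal B] m s' ∧
      g.HasContext P α B c := by
  induction h with
  | nil => simp at hn
  | @terminal t α n s _ ih =>
    have hle : (if P t then 1 else 0) ≤ K := by split <;> omega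
    rw [List.length_cons, add_mul] at hn
    obtain ⟨B, m, c, s', hs', hm, rfl, hB, hc⟩ := ih (by omega)
    refine ⟨B, m, _, s', hs', hm, add_assoc _ _ _, hB, fun n s hn => ?_⟩
    obtain ⟨s'', hs''⟩ := hc n s hn
    exact ⟨s'', by rw [add_assoc]; exact hs''.terminal t⟩
  | @nonterminal r hr α m n s₁ s₂ ho hα _ ih =>
    by_cases hm : K < m
    · refine ⟨r.input, m, n, s₁ + 1, by omega, hm, add_comm _ _, HasYield.singleton hr ho, ?_⟩
      intro m' s hm'
      rw [add_comm]
      exact hm'.append hα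
    · rw [List.length_cons, add_mul] at hn
      obtain ⟨B, m', c, s', hs', hm', rfl, hB, hc⟩ := ih (by omega)
      refine ⟨B, m', _, s', by omega, hm', add_assoc _ _ _, hB, fun n s hn => ?_⟩
      obtain ⟨s'', hs''⟩ := hc n s hn
      exact ⟨_, by rw [add_assoc]; exact HasYield.nonterminal hr ho hs''⟩

/-- A parse tree with many marked terminals has a proper subtree with fewer, but still many,
marked terminals. -/
lemma HasYield.exists_lighter_subtree {b K : ℕ} (hb : ∀ r ∈ g.rules, r.output.length ≤ b)
    (hK : 1 ≤ K) {A : g.NT} {n s : ℕ} (h : g.HasYield P [Symbol.nonterminal A] n s)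
    (hn : b * K < n) :
    ∃ B m c s', K < m ∧ 0 < c ∧ g.HasYield P [Symbol.nonterminal B] m s' ∧
      g.HasContext P [Symbol.nonterminal A] B c := by
  induction s using Nat.strong_induction_on generalizing A with
  | _ s ih =>
    obtain ⟨r, hr, rfl, s₁, hs₁, ho⟩ := h.of_singleton
    obtain ⟨B, m, c, s', hs', hm, hcm, hB, hc⟩ :=
      ho.exists_heavy_root hK ((Nat.mul_le_mul_right K (hb r hr)).trans_lt hn)
    rcases Nat.eq_zero_or_pos c with rfl | hpos
    · obtain rfl : m = n := by omega
      obtain ⟨B', m', c', s'', hm', hc', hB', hctx⟩ := ih s' (by omega) hB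
      exact ⟨B', m', c', s'', hm', hc', hB',
        by simpa using (HasContext.of_output hr hc).trans hctx⟩
    · exact ⟨B, m, c, s', hm, hpos, hB, HasContext.of_output hr hc⟩

lemma HasYield.exists_pumpable [DecidableEq g.NT] {b : ℕ} (hb₁ : 1 ≤ b)
    (hb : ∀ r ∈ g.rules, r.output.length ≤ b) {α : List (Symbol T g.NT)} (F : Finset g.NT)
    {A : g.NT} {n s c₀ : ℕ} (h : g.HasYield P [Symbol.nonterminal A] n s)
    (hn : b ^ ((g.rules.image ContextFreeRule.input \ F).card + 1) < n)
    (hα : g.HasContext P α A c₀)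
    (hF : ∀ B ∈ F, ∃ c, 0 < c ∧ g.HasContext P [Symbol.nonterminal B] A c) :
    ∃ B m c c' s', 0 < c ∧ g.HasYield P [Symbol.nonterminal B] m s' ∧
      g.HasContext P [Symbol.nonterminal B] B c ∧ g.HasContext P α B c' := by
  induction hk : (g.rules.image ContextFreeRule.input \ F).card using Nat.strong_induction_on
    generalizing F A n s c₀ with
  | _ k ih =>
    by_cases hA : A ∈ F
    · obtain ⟨c, hc, hctx⟩ := hF A hA
      exact ⟨A, n, c, c₀, s, hc, h, hctx, hα⟩
    obtain ⟨r, hr, hrA, -⟩ := h.of_singleton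
    have hmem : A ∈ g.rules.image ContextFreeRule.input \ F :=
      Finset.mem_sdiff.2 ⟨Finset.mem_image.2 ⟨r, hr, hrA⟩, hA⟩
    have hcard : (g.rules.image ContextFreeRule.input \ insert A F).card + 1 = k := by
      rw [Finset.sdiff_insert, Finset.card_erase_add_one hmem, hk]
    obtain ⟨B, m, c, s', hm, hc, hB, hctx⟩ :=
      h.exists_lighter_subtree hb (Nat.one_le_pow k b hb₁)
        (by rwa [← pow_succ', ← hk])
    refine ih _ (by omega) (insert A F) hB (by rwa [hcard]) (hα.trans hctx) ?_ rfl
    intro C hC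
    rcases Finset.mem_insert.1 hC with rfl | hC
    · exact ⟨c, hc, hctx⟩
    · obtain ⟨c', hc', hctx'⟩ := hF C hC
      exact ⟨c' + c, by omega, hctx'.trans hctx⟩

end ContextFreeGrammar

/-- If the number of letters satisfying `P` is unbounded on a context-free language, then it takes
all values in some infinite arithmetic progression. -/
theorem Language.IsContextFree.exists_arithmetic_progression {T : Type*} {L : Language T}
    (hL : L.IsContextFree) (P : T → Bool) (hunb : ∀ N, ∃ w ∈ L, N < w.countP P) :
    ∃ a c, 0 < c ∧ ∀ i, ∃ w ∈ L, w.countP P = a + i * c := by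
  classical
  obtain ⟨g, rfl⟩ := hL
  set b := g.rules.sup (fun r => r.output.length) + 1
  have hb : ∀ r ∈ g.rules, r.output.length ≤ b := fun r hr =>
    (Finset.le_sup (f := fun r => r.output.length) hr).trans (Nat.le_succ _)
  obtain ⟨w, hw, hlt⟩ := hunb (b ^ ((g.rules.image ContextFreeRule.input \ ∅).card + 1))
  obtain ⟨s, hs⟩ := ContextFreeGrammar.Derives.exists_hasYield (P := P) hw
  obtain ⟨B, m, c, c', s', hc, hB, hBB, hSB⟩ :=
    hs.exists_pumpable (Nat.le_add_left 1 _) hb ∅ hlt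
      (ContextFreeGrammar.HasContext.refl g.initial) (by simp)
  refine ⟨c' + m, c, hc, fun i => ?_⟩
  obtain ⟨_, h⟩ := (hSB.trans (hBB.iterate i)) m s' hB
  obtain ⟨w', hw', hcount⟩ := h.exists_derives
  exact ⟨w', hw', by rw [hcount]; ring⟩

/-- The values `C * m ^ d` with `2 ≤ d` contain no infinite arithmetic progression. -/
lemma not_forall_exists_mul_pow_eq {C d a c : ℕ} (hC : 0 < C) (hd : 2 ≤ d) (hc : 0 < c) :
    ¬ ∀ i, ∃ m, C * m ^ d = a + i * c := by
  intro H
  obtain ⟨m, hm⟩ := H (C * c ^ d + 1)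
  obtain ⟨m', hm'⟩ := H (C * c ^ d + 1 + 1)
  have hcm : c < m := by
    refine lt_of_pow_lt_pow_left₀ d (Nat.zero_le m) (lt_of_mul_lt_mul_left ?_ (Nat.zero_le C))
    have := Nat.le_mul_of_pos_right (C * c ^ d) hc
    rw [hm, add_mul]
    omega
  have hmm : m < m' := by
    refine lt_of_pow_lt_pow_left₀ d (Nat.zero_le m') (lt_of_mul_lt_mul_left ?_ (Nat.zero_le C))
    rw [hm, hm']
    nlinarith
  have hgap : m ^ d + m ≤ m' ^ d := by
    obtain ⟨e, rfl⟩ := Nat.exists_eq_add_of_le' (show 1 ≤ d by omega)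
    calc m ^ (e + 1) + m ≤ m ^ (e + 1) + m ^ e := by
          gcongr
          exact Nat.le_self_pow (by omega) m
      _ = m ^ e * (m + 1) := by ring
      _ ≤ m' ^ e * m' := by gcongr; omega
      _ = m' ^ (e + 1) := by ring
  have h₁ : C * m ^ d + C * m ≤ C * m' ^ d := by
    rw [← mul_add]
    exact Nat.mul_le_mul_left C hgap
  have h₂ : m ≤ C * m := Nat.le_mul_of_pos_left m hC
  rw [hm, hm', add_mul (C * c ^ d + 1)] at h₁
  omega

lemma List.mem_or_exists_mem_of_mem_intercalate {α : Type*} {sep : List α} {L : List (List α)}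
    {a : α} (h : a ∈ sep.intercalate L) : a ∈ sep ∨ ∃ l ∈ L, a ∈ l := by
  induction L with
  | nil => simp [List.intercalate_nil] at h
  | cons l L ih =>
    rcases eq_or_ne L [] with rfl | hL
    · exact Or.inr ⟨l, by simp, by simpa [List.intercalate_singleton] using h⟩
    · rw [List.intercalate_cons_of_ne_nil hL, List.mem_append, List.mem_append] at h
      rcases h with (h | h) | h
      · exact Or.inr ⟨l, by simp, h⟩
      · exact Or.inl h
      · exact (ih h).imp_right fun ⟨l', hl', ha⟩ => ⟨l', List.mem_cons_of_mem l hl', ha⟩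

section Encoding

variable {q k p : ℕ}

lemma rhd_notMem_unary (z : ℤ) : (Symb.rhd : Symb q p) ∉ unary z := by
  unfold unary
  split <;> simp [List.mem_replicate]

lemma rhd_notMem_encAddr (a : Option ℤ) : (Symb.rhd : Symb q p) ∉ encAddr a := by
  cases a with
  | none => simp [encAddr]
  | some z => exact rhd_notMem_unary z

lemma count_rhd_encInt (I : LocInt k p) : (encInt (q := q) I).count Symb.rhd = 1 := by
  have hmem : (Symb.rhd : Symb q p) ∉
      List.intercalate [Symb.blank] (List.ofFn fun l => encAddr (I.2 l)) := by
    intro h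
    rcases List.mem_or_exists_mem_of_mem_intercalate h with h | ⟨l, hl, h⟩
    · simp at h
    · obtain ⟨i, rfl⟩ := List.mem_ofFn.1 hl
      exact rhd_notMem_encAddr _ h
  simp [encInt, List.count_eq_zero_of_not_mem hmem]

lemma count_rhd_encConfig (x : Config q k p) : (encConfig x).count Symb.rhd = x.length := by
  induction x with
  | nil => rfl
  | cons a x ih =>
    have hcons : encConfig (a :: x) = Symb.spin a.1 :: encInt a.2 ++ encConfig x := rfl
    rw [hcons, List.count_append, ih, List.count_cons, count_rhd_encInt]
    simp [add_comm]

lemma count_rhd_word (x : Config q k p) (z : ℤ) :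
    (encConfig x ++ [Symb.comp] ++ unary z ++ [Symb.bullet]).count Symb.rhd = x.length := by
  simp [List.count_append, count_rhd_encConfig,
    List.count_eq_zero_of_not_mem (rhd_notMem_unary z)]

/-- Every admissible lattice size is attained by a configuration in the domain. -/
lemma exists_mem_domainDD {d : ℕ} (hq : 0 < q) (ℓ : Fin d → ℕ)
    {V : Set (Fin p × (Fin k → Fin d → ℤ))} (hV : V.Nonempty) {m : ℕ} (hm : 1 ≤ m) :
    ∃ x ∈ DomainDD (q := q) d ℓ V, x.length = ∏ i, m * ℓ i := by
  obtain ⟨v, hv⟩ := hV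
  refine ⟨List.ofFn fun j : Fin (∏ i, m * ℓ i) =>
    (⟨0, hq⟩, (v.1, fun l => Zfun (fun i => m * ℓ i) (j : ℕ) (v.2 l))), ?_, by simp⟩
  exact ⟨m, hm, by simp, fun j => ⟨v, hv, by simp⟩⟩

end Encoding

/-- If `H` is a dD spin Hamiltonian with `d ≥ 2`, then its language
`L_H` is not context-free. -/
theorem dD_not_contextFree {q k p : ℕ} (hq : 0 < q) (hk : 0 < k) (hp : 0 < p)
    (h : Fin p → (Fin k → Option (Fin q)) → ℤ)
    (d : ℕ) (hd : 2 ≤ d) (ℓ : Fin d → ℕ) (hℓ : ∀ i, 0 < ℓ i)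
    (V : Set (Fin p × (Fin k → Fin d → ℤ))) (hV : V.Nonempty)
    (hVk : ∀ αv ∈ V, ∀ l : Fin k, ∑ i, (αv.2 l i).natAbs ≤ k) :
    ¬ (langH h (DomainDD d ℓ V)).IsContextFree := by
  intro hcf
  have hprod (m : ℕ) : ∏ i, m * ℓ i = (∏ i, ℓ i) * m ^ d := by
    simp [Finset.prod_mul_distrib, mul_comm]
  have hC : 0 < ∏ i, ℓ i := Finset.prod_pos fun i _ => hℓ i
  obtain ⟨a, c, hc, hap⟩ := hcf.exists_arithmetic_progression (· == Symb.rhd) fun N => by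
    obtain ⟨x, hx, hlen⟩ := exists_mem_domainDD hq ℓ hV (Nat.le_add_left 1 N)
    refine ⟨_, ⟨x, hx, rfl⟩, ?_⟩
    refine lt_of_lt_of_eq ?_ (count_rhd_word x _).symm
    rw [hlen, hprod]
    calc N < N + 1 := Nat.lt_succ_self N
      _ ≤ (N + 1) ^ d := Nat.le_self_pow (by omega) _
      _ ≤ _ := Nat.le_mul_of_pos_left _ hC
  refine not_forall_exists_mul_pow_eq (a := a) hC hd hc fun i => ?_
  obtain ⟨w, ⟨x, ⟨m, -, hlen, -⟩, rfl⟩, hw⟩ := hap i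
  exact ⟨m, by rw [← hprod, ← hlen, ← hw]; exact (count_rhd_word x _).symm⟩
end

section
/- If H is an all-to-all spin Hamiltonian with locality k ≥ 2, then its language L_H is not a context-free language. -/
/-- A local interaction of an all-to-all Hamiltonian: a label and `k` integer addresses. -/
abbrev AInt (k p : ℕ) := Fin p × (Fin k → ℤ)

/-- A configuration `(s_1, J_1, …, s_n, J_n)` of an all-to-all spin Hamiltonian, where
each `J_j` is a list of local interactions. -/
abbrev AConfig (q k p : ℕ) := List (Fin q × List (AInt k p))

/-- A valid address tuple `(0, a_1, …, a_{k−1})` with `0 < a_1 < ⋯ < a_{k−1} ≤ n − j`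
at (0-based) site `j` of a system of `n` spins. -/
def isAddrTuple {k : ℕ} (n j : ℕ) (A : Fin k → ℤ) : Prop :=
  (∀ l : Fin k, (l : ℕ) = 0 → A l = 0) ∧ StrictMono A ∧
    ∀ l : Fin k, A l ≤ (n : ℤ) - ((j : ℤ) + 1)

/-- Strict lexicographic order on address tuples. -/
def lexLt {k : ℕ} (A B : Fin k → ℤ) : Prop :=
  ∃ l : Fin k, (∀ m < l, A m = B m) ∧ A l < B l

/-- `J ∈ 𝓙_{n,j}`: the address tuples of `J` are exactly the valid address tuples at
site `j`, listed in (strictly increasing) lexicographic order; the labels are arbitrary. -/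
def validJ {k p : ℕ} (n j : ℕ) (J : List (AInt k p)) : Prop :=
  (J.map Prod.snd).Pairwise lexLt ∧
    ∀ A : Fin k → ℤ, A ∈ J.map Prod.snd ↔ isAddrTuple n j A

/-- The domain `𝒟_all` of an all-to-all spin Hamiltonian. -/
def DomainAll (q k p : ℕ) : Set (AConfig q k p) :=
  {x | x ≠ [] ∧ ∀ j : Fin x.length, validJ x.length (j : ℕ) (x.get j).2}

/-- The spin at integer address `l` relative to (0-based) position `j` (▲ if outside). -/
def spinAtA {q k p : ℕ} (x : AConfig q k p) (j : ℕ) (l : ℤ) : Option (Fin q) :=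
  if 0 ≤ (j : ℤ) + l then (x[((j : ℤ) + l).toNat]?).map Prod.fst else none

/-- `H(s_1,J_1,…,s_n,J_n) = Σ_j Σ_{(α,A) ∈ J_j} h_α((s_{j+l})_{l ∈ A})`. -/
def energyA {q k p : ℕ} (h : Fin p → (Fin k → Option (Fin q)) → ℤ)
    (x : AConfig q k p) : ℤ :=
  ∑ j : Fin x.length,
    ((x.get j).2.map fun IA => h IA.1 fun l => spinAtA x (j : ℕ) (IA.2 l)).sum

/-- `γ(α, (a_1,…,a_k)) = α ◁ u(a_1) ␣ ⋯ ␣ u(a_k) ▷`. -/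
def encIntA {q k p : ℕ} (I : AInt k p) : List (Symb q p) :=
  [Symb.ham I.1, Symb.lhd] ++
    List.intercalate [Symb.blank] (List.ofFn fun l => unary (I.2 l)) ++ [Symb.rhd]

/-- `e(s_1,J_1,…,s_n,J_n) = s_1 γ(J_1) ⋯ s_n γ(J_n)`, where `γ(I_1,…,I_m) = γ(I_1)⋯γ(I_m)`. -/
def encConfigA {q k p : ℕ} (x : AConfig q k p) : List (Symb q p) :=
  (x.map fun sJ => Symb.spin sJ.1 :: (sJ.2.map encIntA).flatten).flatten

/-- The language `L_H = { e(x) ∘ u(H(x)) • : x ∈ 𝒟_all }`. -/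
def langHA {q k p : ℕ} (h : Fin p → (Fin k → Option (Fin q)) → ℤ)
    (D : Set (AConfig q k p)) : Language (Symb q p) :=
  {w | ∃ x ∈ D, w = encConfigA x ++ [Symb.comp] ++ unary (energyA h x) ++ [Symb.bullet]}

namespace ContextFreeGrammar

variable {T : Type*} {g : ContextFreeGrammar T}

/-- `g.DerivesIn S s w n`: the string `s` derives the terminal word `w` by a forest of derivation
trees with `n` nodes, all of whose nonterminals lie in `S`. -/
inductive DerivesIn (g : ContextFreeGrammar T) (S : Finset g.NT) :
    List (Symbol T g.NT) → List T → ℕ → Prop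
  | nil : DerivesIn g S [] [] 0
  | terminal (t : T) {s : List (Symbol T g.NT)} {w : List T} {n : ℕ} (hs : DerivesIn g S s w n) :
      DerivesIn g S (.terminal t :: s) (t :: w) (n + 1)
  | nonterminal {r : ContextFreeRule T g.NT} (hr : r ∈ g.rules) (hrS : r.input ∈ S)
      {s : List (Symbol T g.NT)} {w₁ w₂ : List T} {n₁ n₂ : ℕ}
      (hout : DerivesIn g S r.output w₁ n₁) (hs : DerivesIn g S s w₂ n₂) :
      DerivesIn g S (.nonterminal r.input :: s) (w₁ ++ w₂) (n₁ + n₂ + 1)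

lemma Derives.append {s₁ s₂ t₁ t₂ : List (Symbol T g.NT)} (h₁ : g.Derives s₁ t₁)
    (h₂ : g.Derives s₂ t₂) : g.Derives (s₁ ++ s₂) (t₁ ++ t₂) :=
  (h₁.append_right s₂).trans (h₂.append_left t₁)

lemma derives_output {r : ContextFreeRule T g.NT} (hr : r ∈ g.rules) :
    g.Derives [.nonterminal r.input] r.output :=
  Produces.single ⟨r, hr, ContextFreeRule.Rewrites.input_output⟩

lemma DerivesIn.derives {S : Finset g.NT} {s : List (Symbol T g.NT)} {w : List T} {n : ℕ}
    (h : g.DerivesIn S s w n) : g.Derives s (w.map .terminal) := by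
  induction h with
  | nil => exact Derives.refl _
  | terminal t _ ih => exact ih.append_left [.terminal t]
  | nonterminal hr _ _ _ ih₁ ih₂ =>
    rw [List.map_append]
    exact ((derives_output hr).trans ih₁).append ih₂

lemma derivesIn_map_terminal (S : Finset g.NT) (w : List T) :
    ∃ n, g.DerivesIn S (w.map .terminal) w n := by
  induction w with
  | nil => exact ⟨0, .nil⟩
  | cons t w ih =>
    obtain ⟨n, hn⟩ := ih
    exact ⟨n + 1, .terminal t hn⟩

lemma DerivesIn.append {S : Finset g.NT} {s₁ s₂ : List (Symbol T g.NT)} {w₁ w₂ : List T}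
    {n₁ n₂ : ℕ} (h₁ : g.DerivesIn S s₁ w₁ n₁) (h₂ : g.DerivesIn S s₂ w₂ n₂) :
    ∃ n, g.DerivesIn S (s₁ ++ s₂) (w₁ ++ w₂) n := by
  induction h₁ with
  | nil => exact ⟨n₂, h₂⟩
  | terminal t _ ih =>
    obtain ⟨n, hn⟩ := ih
    exact ⟨n + 1, .terminal t hn⟩
  | nonterminal hr hrS hout _ _ ih =>
    obtain ⟨n, hn⟩ := ih
    rw [List.append_assoc]
    exact ⟨_, .nonterminal hr hrS hout hn⟩

lemma DerivesIn.exists_of_append {S : Finset g.NT} {s₁ s₂ : List (Symbol T g.NT)} {w : List T}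
    {n : ℕ} (h : g.DerivesIn S (s₁ ++ s₂) w n) :
    ∃ w₁ w₂ n₁ n₂, w = w₁ ++ w₂ ∧ g.DerivesIn S s₁ w₁ n₁ ∧ g.DerivesIn S s₂ w₂ n₂ := by
  induction s₁ generalizing w n with
  | nil => exact ⟨[], w, 0, n, rfl, .nil, h⟩
  | cons a s₁ ih =>
    cases h with
    | terminal t hs =>
      obtain ⟨w₁, w₂, n₁, n₂, rfl, h₁, h₂⟩ := ih hs
      exact ⟨t :: w₁, w₂, _, _, rfl, .terminal t h₁, h₂⟩
    | nonterminal hr hrS hout hs =>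
      obtain ⟨w₁, w₂, n₁, n₂, rfl, h₁, h₂⟩ := ih hs
      exact ⟨_, w₂, _, _, (List.append_assoc _ _ _).symm, .nonterminal hr hrS hout h₁, h₂⟩

lemma Derives.exists_derivesIn {S : Finset g.NT} (hS : ∀ r ∈ g.rules, r.input ∈ S)
    {s : List (Symbol T g.NT)} {w : List T} (h : g.Derives s (w.map .terminal)) :
    ∃ n, g.DerivesIn S s w n := by
  induction h using Relation.ReflTransGen.head_induction_on with
  | refl => exact derivesIn_map_terminal S w
  | head hp _ ih =>
    obtain ⟨r, hr, hrew⟩ := hp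
    obtain ⟨p, q, rfl, rfl⟩ := hrew.exists_parts
    obtain ⟨n, hn⟩ := ih
    obtain ⟨w', w₃, _, _, rfl, h', h₃⟩ := hn.exists_of_append
    obtain ⟨w₁, w₂, _, _, rfl, h₁, h₂⟩ := h'.exists_of_append
    obtain ⟨_, hA⟩ := h₁.append (.nonterminal hr (hS r hr) h₂ .nil)
    obtain ⟨n, hn⟩ := hA.append h₃
    exact ⟨n, by simpa using hn⟩

lemma DerivesIn.erase_or_exists [DecidableEq g.NT] {S : Finset g.NT} {s : List (Symbol T g.NT)}
    {w : List T} {n : ℕ} (h : g.DerivesIn S s w n) (A : g.NT) :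
    g.DerivesIn (S.erase A) s w n ∨ ∃ v x y m, m ≤ n ∧ w = v ++ x ++ y ∧
      g.Derives s (v.map .terminal ++ [.nonterminal A] ++ y.map .terminal) ∧
      g.DerivesIn S [.nonterminal A] x m := by
  induction h with
  | nil => exact .inl .nil
  | terminal t _ ih =>
    rcases ih with ih | ⟨v, x, y, m, hm, rfl, hd, hA⟩
    · exact .inl (.terminal t ih)
    · exact .inr ⟨t :: v, x, y, m, by lia, rfl, hd.append_left [.terminal t], hA⟩
  | @nonterminal r hr hrS s w₁ w₂ n₁ n₂ hout hs ih₁ ih₂ =>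
    by_cases hrA : r.input = A
    · subst hrA
      refine .inr ⟨[], w₁, w₂, n₁ + 0 + 1, by lia, rfl, hs.derives.append_left [_], ?_⟩
      simpa using DerivesIn.nonterminal hr hrS hout .nil
    rcases ih₁ with ih₁ | ⟨v, x, y, m, hm, rfl, hd, hA⟩
    · rcases ih₂ with ih₂ | ⟨v, x, y, m, hm, rfl, hd, hA⟩
      · exact .inl (.nonterminal hr (Finset.mem_erase.2 ⟨hrA, hrS⟩) ih₁ ih₂)
      · refine .inr ⟨w₁ ++ v, x, y, m, by lia, by simp, ?_, hA⟩
        simpa using ((derives_output hr).trans hout.derives).append hd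
    · refine .inr ⟨v, x, y ++ w₂, m, by lia, by simp, ?_, hA⟩
      simpa using ((derives_output hr).trans hd).append hs.derives

/-- If no self-embedding `A ⇒* v A y` of a useful nonterminal `A` produces a letter satisfying `c`,
then the number of such letters is bounded in terms of the nonterminals available. -/
lemma DerivesIn.countP_le [DecidableEq g.NT] {c : T → Bool} {K : ℕ}
    (hK : ∀ r ∈ g.rules, r.output.length ≤ K) (hK₁ : 1 ≤ K)
    (hc : ∀ (A : g.NT) (p q v x y : List T),
      g.Derives [.nonterminal g.initial]
        (p.map .terminal ++ [.nonterminal A] ++ q.map .terminal) →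
      g.Derives [.nonterminal A] (v.map .terminal ++ [.nonterminal A] ++ y.map .terminal) →
      g.Derives [.nonterminal A] (x.map .terminal) → (v ++ y).countP c = 0)
    {n : ℕ} {S : Finset g.NT} {s : List (Symbol T g.NT)} {w p q : List T}
    (h : g.DerivesIn S s w n)
    (hs : g.Derives [.nonterminal g.initial] (p.map .terminal ++ s ++ q.map .terminal)) :
    w.countP c ≤ s.length * K ^ S.card := by
  induction n using Nat.strong_induction_on generalizing S s w p q with
  | _ n ih =>
  cases h with
  | nil => simp
  | @terminal t s w n h' =>
    have := ih n (by lia) h' (p := p ++ [t]) (q := q) (by simpa using hs)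
    have hpos : 1 ≤ K ^ S.card := Nat.one_le_pow _ _ hK₁
    have : (if c t = true then 1 else 0) ≤ 1 := by split_ifs <;> simp
    rw [List.countP_cons, List.length_cons, add_mul]
    lia
  | @nonterminal r hr hrS s w₁ w₂ n₁ n₂ hout h' =>
    have hs₂ : g.Derives [.nonterminal g.initial]
        ((p ++ w₁).map .terminal ++ s ++ q.map .terminal) := by
      refine hs.trans ?_
      have := (((derives_output hr).trans hout.derives).append_right
        (s ++ q.map .terminal)).append_left (p.map .terminal)
      simpa using this
    have hA : g.Derives [.nonterminal g.initial]
        (p.map .terminal ++ [.nonterminal r.input] ++ (w₂ ++ q).map .terminal) := by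
      refine hs.trans ?_
      have := (h'.derives.append_right (q.map .terminal)).append_left
        (p.map .terminal ++ [.nonterminal r.input])
      simpa using this
    have h₂ := ih n₂ (by lia) h' hs₂
    have h₁ : w₁.countP c ≤ K ^ S.card := by
      rcases hout.erase_or_exists r.input with he | ⟨v, x, y, m, hm, rfl, hd, hx⟩
      · have hs₁ : g.Derives [.nonterminal g.initial]
            (p.map .terminal ++ r.output ++ (w₂ ++ q).map .terminal) :=
          hA.trans (((derives_output hr).append_left _).append_right _)
        have := ih n₁ (by lia) he hs₁
        have hcard : S.card = (S.erase r.input).card + 1 := by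
          have := Finset.card_erase_add_one hrS
          lia
        rw [hcard, pow_succ']
        exact this.trans (Nat.mul_le_mul_right _ (hK r hr))
      · have hd' := (derives_output hr).trans hd
        have hzero := hc r.input p (w₂ ++ q) v x y hA hd' hx.derives
        have hsx : g.Derives [.nonterminal g.initial] ((p ++ v).map .terminal ++
            [.nonterminal r.input] ++ (y ++ (w₂ ++ q)).map .terminal) := by
          have := hA.trans ((hd'.append_left (p.map .terminal)).append_right
            ((w₂ ++ q).map .terminal))
          simpa using this
        have := ih m (by lia) hx hsx
        simp only [List.countP_append, List.length_singleton, one_mul] at this hzero ⊢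
        lia
    rw [List.countP_append, List.length_cons, add_mul]
    lia

lemma Derives.pump {A : g.NT} {v x y : List T}
    (hv : g.Derives [.nonterminal A] (v.map .terminal ++ [.nonterminal A] ++ y.map .terminal))
    (hx : g.Derives [.nonterminal A] (x.map .terminal)) (i : ℕ) :
    g.Derives [.nonterminal A]
      (((List.replicate i v).flatten ++ x ++ (List.replicate i y).flatten).map .terminal) := by
  induction i with
  | zero => simpa using hx
  | succ i ih =>
    have := hv.trans ((ih.append_left (v.map .terminal)).append_right (y.map .terminal))
    rw [List.replicate_succ, List.replicate_succ']
    simpa using this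

end ContextFreeGrammar

/-- Pumping lemma with marked letters: if the words of a context-free language contain arbitrarily
many letters satisfying `c`, then some word can be pumped so that the number of these letters
grows. -/
theorem Language.IsContextFree.exists_pump {T : Type*} {L : Language T} (hL : L.IsContextFree)
    (c : T → Bool) (hc : ∀ N, ∃ w ∈ L, N ≤ w.countP c) :
    ∃ p v x y q : List T, 0 < (v ++ y).countP c ∧
      ∀ i, p ++ ((List.replicate i v).flatten ++ x ++ (List.replicate i y).flatten) ++ q ∈ L := by
  classical
  obtain ⟨g, rfl⟩ := hL
  by_contra! hno
  set K := g.rules.sup (fun r => r.output.length) + 1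
  set S := g.rules.image ContextFreeRule.input
  obtain ⟨w, hw, hN⟩ := hc (K ^ S.card + 1)
  obtain ⟨n, hn⟩ := ContextFreeGrammar.Derives.exists_derivesIn (S := S)
    (fun r hr => Finset.mem_image_of_mem _ hr) ((g.mem_language_iff w).1 hw)
  have := hn.countP_le (c := c) (K := K) (p := []) (q := [])
    (fun r hr => (Finset.le_sup (f := fun r => r.output.length) hr).trans (Nat.le_succ _))
    (Nat.le_add_left _ _) ?_ (ContextFreeGrammar.Derives.refl _)
  · simp only [List.length_singleton, one_mul] at this
    lia
  · intro A p q v x y hA hv hx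
    by_contra hpos
    obtain ⟨i, hi⟩ := hno p v x y q (Nat.pos_of_ne_zero hpos)
    refine hi ((g.mem_language_iff _).2 (hA.trans ?_))
    have := ((hv.pump hx i).append_left (p.map .terminal)).append_right (q.map .terminal)
    simpa using this

/-- Whether a letter is a spin symbol. -/
def Symb.isSpin {q p : ℕ} : Symb q p → Bool
  | .spin _ => true
  | _ => false

/-- Whether a letter is `▷`. -/
def Symb.isRhd {q p : ℕ} : Symb q p → Bool
  | .rhd => true
  | _ => false

lemma List.exists_mem_of_mem_intercalate {α : Type*} {s : List α} {l : List (List α)} {a : α}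
    (h : a ∈ s.intercalate l) : a ∈ s ∨ ∃ t ∈ l, a ∈ t := by
  induction l with
  | nil => simp [List.intercalate] at h
  | cons t l ih =>
    cases l with
    | nil => simp_all [List.intercalate]
    | cons t' l =>
      simp only [List.intercalate, List.intersperse_cons_cons, List.flatten_cons,
        List.mem_append] at h ih
      rcases h with h | h | h
      · exact .inr ⟨t, by simp, h⟩
      · exact .inl h
      · rcases ih h with ih | ⟨u, hu, ha⟩
        · exact .inl ih
        · exact .inr ⟨u, List.mem_cons_of_mem _ hu, ha⟩

section Counting

variable {q k p : ℕ}

lemma countP_unary {c : Symb q p → Bool} (hdia : c .dia = false) (hsq : c .sq = false) (z : ℤ) :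
    (unary z : List (Symb q p)).countP c = 0 := by
  unfold unary
  split_ifs <;> simp [List.countP_replicate, hdia, hsq]

lemma countP_intercalate_unary {c : Symb q p → Bool} (hdia : c .dia = false)
    (hsq : c .sq = false) (hblank : c .blank = false) (A : Fin k → ℤ) :
    (List.intercalate [Symb.blank] (List.ofFn fun l => unary (A l)) : List (Symb q p)).countP c
      = 0 := by
  rw [List.countP_eq_zero]
  intro a ha
  rcases List.exists_mem_of_mem_intercalate ha with ha | ⟨t, ht, ha⟩
  · simp_all
  · obtain ⟨l, rfl⟩ := List.mem_ofFn.1 ht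
    exact List.countP_eq_zero.1 (countP_unary hdia hsq (A l)) a ha

lemma countP_isSpin_encIntA (I : AInt k p) :
    (encIntA I : List (Symb q p)).countP Symb.isSpin = 0 := by
  rw [encIntA, List.countP_append, List.countP_append, countP_intercalate_unary rfl rfl rfl]
  rfl

lemma countP_isRhd_encIntA (I : AInt k p) :
    (encIntA I : List (Symb q p)).countP Symb.isRhd = 1 := by
  rw [encIntA, List.countP_append, List.countP_append, countP_intercalate_unary rfl rfl rfl]
  rfl

lemma countP_isSpin_encConfigA (x : AConfig q k p) :
    (encConfigA x).countP Symb.isSpin = x.length := by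
  have (J : List (AInt k p)) :
      ((J.map encIntA).flatten : List (Symb q p)).countP Symb.isSpin = 0 := by
    induction J with
    | nil => rfl
    | cons I J ih => simp [countP_isSpin_encIntA, ih]
  unfold encConfigA
  induction x with
  | nil => rfl
  | cons a x ih => simp [this, ih, Symb.isSpin, List.countP_cons, add_comm]

lemma countP_isRhd_encConfigA (x : AConfig q k p) :
    (encConfigA x).countP Symb.isRhd = (x.map fun a => a.2.length).sum := by
  have (J : List (AInt k p)) :
      ((J.map encIntA).flatten : List (Symb q p)).countP Symb.isRhd = J.length := by
    induction J with
    | nil => rfl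
    | cons I J ih => simp [countP_isRhd_encIntA, ih, add_comm]
  unfold encConfigA
  induction x with
  | nil => rfl
  | cons a x ih => simp [this, ih, Symb.isRhd]

lemma finite_isAddrTuple (n j : ℕ) : {A : Fin k → ℤ | isAddrTuple n j A}.Finite := by
  refine (Set.finite_Icc (0 : Fin k → ℤ) fun _ => (n : ℤ) - ((j : ℤ) + 1)).subset ?_
  rintro A ⟨h₀, hmono, hle⟩
  refine ⟨fun l => ?_, hle⟩
  rw [Pi.zero_apply, ← h₀ ⟨0, by have := l.2; lia⟩ rfl]
  exact hmono.monotone (Nat.zero_le _)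

/-- The number of address tuples available at a site with `m` sites to its right. -/
noncomputable def addrCount (k m : ℕ) : ℕ :=
  {A : Fin k → ℤ | isAddrTuple (m + 1) 0 A}.ncard

lemma validJ.length_eq {n j : ℕ} {J : List (AInt k p)} (hJ : validJ n j J) (hj : j < n) :
    J.length = addrCount k (n - 1 - j) := by
  have hnodup : (J.map Prod.snd).Nodup := by
    refine hJ.1.imp ?_
    rintro A B ⟨l, -, hl⟩ rfl
    exact hl.false
  have hset : {A : Fin k → ℤ | isAddrTuple (n - 1 - j + 1) 0 A}
      = ((J.map Prod.snd).toFinset : Set (Fin k → ℤ)) := by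
    ext A
    have : ((n - 1 - j + 1 : ℕ) : ℤ) - (((0 : ℕ) : ℤ) + 1) = (n : ℤ) - ((j : ℤ) + 1) := by lia
    rw [List.coe_toFinset, Set.mem_ofPred_eq, Set.mem_ofPred_eq, hJ.2 A, isAddrTuple, isAddrTuple,
      this]
  rw [addrCount, hset, Set.ncard_coe_finset, List.toFinset_card_of_nodup hnodup, List.length_map]

lemma exists_validJ (hp : 0 < p) (n j : ℕ) : ∃ J : List (AInt k p), validJ n j J := by
  classical
  let F : Finset (Lex (Fin k → ℤ)) :=
    (finite_isAddrTuple (k := k) n j).toFinset.map toLex.toEmbedding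
  refine ⟨F.sort.map fun A => (⟨0, hp⟩, ofLex A), ?_, fun A => ?_⟩
  · rw [List.map_map, List.pairwise_map]
    exact (Finset.sortedLT_sort F).pairwise.imp fun {A B} hAB => hAB
  · simp [F]

lemma exists_mem_domainAll (hq : 0 < q) (hp : 0 < p) {n : ℕ} (hn : n ≠ 0) :
    ∃ x ∈ DomainAll q k p, x.length = n := by
  choose J hJ using fun j => exists_validJ (k := k) hp n j
  refine ⟨List.ofFn fun j : Fin n => (⟨0, hq⟩, J j), ⟨?_, fun j => ?_⟩, by simp⟩
  · simpa [List.ofFn_eq_nil_iff] using hn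
  · simpa using hJ j

lemma sum_length_of_mem_domainAll {x : AConfig q k p} (hx : x ∈ DomainAll q k p) :
    (x.map fun a => a.2.length).sum = ∑ m ∈ Finset.range x.length, addrCount k m := by
  rw [← Finset.sum_range_reflect, Finset.sum_range, ← Fin.sum_univ_fun_getElem]
  exact Finset.sum_congr rfl fun j _ => (hx.2 j).length_eq j.2

lemma le_addrCount (hk : 2 ≤ k) (M : ℕ) : M ≤ addrCount k (k * M) := by
  let f : ℕ → Fin k → ℤ := fun t l => (l : ℤ) * (t + 1)
  have hinj : Function.Injective f := fun s t hst => by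
    have := congrFun hst ⟨1, hk⟩
    simpa [f] using this
  have hsub : ((Finset.range M).map ⟨f, hinj⟩ : Set (Fin k → ℤ))
      ⊆ {A | isAddrTuple (k * M + 1) 0 A} := by
    intro A hA
    simp only [Finset.coe_map, Function.Embedding.coeFn_mk, Set.mem_image, Finset.coe_range,
      Set.mem_Iio] at hA
    obtain ⟨t, ht, rfl⟩ := hA
    refine ⟨fun l hl => by simp [f, hl], fun l l' hl => ?_, fun l => ?_⟩
    · exact mul_lt_mul_of_pos_right (by exact_mod_cast hl) (by positivity)
    · have : (l : ℕ) * (t + 1) ≤ k * M := Nat.mul_le_mul l.2.le ht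
      simp only [f]
      push_cast
      have : ((l : ℕ) : ℤ) * (t + 1) ≤ k * M := by exact_mod_cast this
      lia
  have hle := Set.ncard_le_ncard hsub (finite_isAddrTuple (k * M + 1) 0)
  rwa [Set.ncard_coe_finset, Finset.card_map, Finset.card_range] at hle

lemma countP_of_mem_langHA {h : Fin p → (Fin k → Option (Fin q)) → ℤ} {w : List (Symb q p)}
    (hw : w ∈ langHA h (DomainAll q k p)) :
    w.countP Symb.isRhd = ∑ m ∈ Finset.range (w.countP Symb.isSpin), addrCount k m := by
  obtain ⟨x, hx, rfl⟩ := hw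
  simp only [List.countP_append, countP_isSpin_encConfigA, countP_isRhd_encConfigA,
    countP_unary (c := Symb.isSpin) rfl rfl, countP_unary (c := Symb.isRhd) rfl rfl,
    sum_length_of_mem_domainAll hx]
  simp [Symb.isSpin, Symb.isRhd]

end Counting


/-- If `H` is an all-to-all spin Hamiltonian with locality `k ≥ 2`, then
its language `L_H` is not context-free. -/
theorem allToAll_not_contextFree {q k p : ℕ} (hq : 0 < q) (hk : 2 ≤ k) (hp : 0 < p)
    (h : Fin p → (Fin k → Option (Fin q)) → ℤ) :
    ¬ (langHA h (DomainAll q k p)).IsContextFree := by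
  intro hL
  obtain ⟨u, v, x, y, z, hpos, hmem⟩ := hL.exists_pump Symb.isSpin fun N => by
    obtain ⟨x, hx, hlen⟩ := exists_mem_domainAll (k := k) hq hp N.succ_ne_zero
    refine ⟨_, ⟨x, hx, rfl⟩, ?_⟩
    simp only [List.countP_append, countP_isSpin_encConfigA, hlen]
    lia
  have hcount (c : Symb q p → Bool) (i : ℕ) :
      (u ++ ((List.replicate i v).flatten ++ x ++ (List.replicate i y).flatten) ++ z).countP c
        = (u ++ x ++ z).countP c + i * (v ++ y).countP c := by
    simp only [List.countP_append, List.countP_flatten, List.map_replicate, List.sum_replicate,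
      smul_eq_mul]
    ring
  set n := (u ++ x ++ z).countP Symb.isSpin
  set a := (v ++ y).countP Symb.isSpin
  set m := (u ++ x ++ z).countP Symb.isRhd
  set b := (v ++ y).countP Symb.isRhd
  have hsum (i : ℕ) : m + i * b = ∑ t ∈ Finset.range (n + i * a), addrCount k t := by
    simpa only [hcount] using countP_of_mem_langHA (hmem i)
  have hblock (i : ℕ) : ∑ r ∈ Finset.range a, addrCount k (n + i * a + r) = b := by
    have h₁ := hsum (i + 1)
    rw [add_mul, add_mul, one_mul, one_mul, ← add_assoc, ← add_assoc, Finset.sum_range_add,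
      ← hsum i] at h₁
    lia
  have hle (t : ℕ) (ht : n ≤ t) : addrCount k t ≤ b := by
    rw [← hblock ((t - n) / a)]
    have hdiv : n + (t - n) / a * a + (t - n) % a = t := by
      have := Nat.div_add_mod' (t - n) a
      lia
    conv_lhs => rw [← hdiv]
    exact Finset.single_le_sum (f := fun r => addrCount k (n + (t - n) / a * a + r))
      (fun _ _ => Nat.zero_le _) (Finset.mem_range.2 (Nat.mod_lt _ hpos))
  have h₁ := hle (k * (n + b + 1)) (by nlinarith)
  have h₂ := le_addrCount hk (n + b + 1)
  lia
end

section
/- Let H be a 1D spin Hamiltonian with periodic boundary conditions. If the image H(𝒟) is a bounded subset of ℤ, then H is identically zero on its domain. (Key step: for every configuration x = (s_1,I_1,…,s_n,I_n) and its doubled configuration x² = (s_1,I_1,…,s_n,I_n,s_1,I_1,…,s_n,I_n), one has H(x²) = 2·H(x).) -/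
/-- The spin addressed by `a` relative to position `j`, with periodic boundary
conditions: position `(j + l) mod n`; ▲ only when `a = ▲`. -/
def spinAtPer {q k p : ℕ} (x : Config q k p) (j : ℕ) : Option ℤ → Option (Fin q)
  | none => none
  | some l => (x[(((j : ℤ) + l) % (x.length : ℤ)).toNat]?).map Prod.fst

/-- The energy with periodic boundary conditions. -/
def energyPer {q k p : ℕ} (h : Fin p → (Fin k → Option (Fin q)) → ℤ)
    (x : Config q k p) : ℤ :=
  ∑ j : Fin x.length, h (x.get j).2.1 (fun l => spinAtPer x (j : ℕ) ((x.get j).2.2 l))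

theorem getElem?_append_self_emod {α : Type*} (x : List α) (hx : x ≠ []) (z : ℤ) :
    (x ++ x)[(z % ((x ++ x).length : ℤ)).toNat]? = x[(z % (x.length : ℤ)).toNat]? := by
  have hn : 0 < (x.length : ℤ) := by exact_mod_cast List.length_pos_iff.mpr hx
  have hlen : ((x ++ x).length : ℤ) = x.length * 2 := by simp; ring
  rw [hlen]
  set n : ℤ := (x.length : ℤ) with hn'
  have h0 : 0 ≤ z % (n * 2) := Int.emod_nonneg _ (by omega)
  have h1 : z % (n * 2) < n * 2 := Int.emod_lt_of_pos _ (by omega)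
  rw [← Int.emod_emod_of_dvd z (Dvd.intro 2 rfl : n ∣ n * 2)]
  generalize z % (n * 2) = w at h0 h1
  by_cases hw : w < n
  · rw [Int.emod_eq_of_lt h0 hw, List.getElem?_append_left (by omega)]
  · have hm : w % n = w - n := by
      rw [← Int.sub_emod_right, Int.emod_eq_of_lt (by omega) (by omega)]
    rw [hm, List.getElem?_append_right (by omega)]
    congr 1
    omega

theorem spinAtPer_append_self {q k p : ℕ} (x : Config q k p) (hx : x ≠ []) (j : ℕ)
    (a : Option ℤ) : spinAtPer (x ++ x) j a = spinAtPer x j a := by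
  cases a with
  | none => rfl
  | some l => simp only [spinAtPer, getElem?_append_self_emod x hx]

theorem spinAtPer_length_add {q k p : ℕ} (x : Config q k p) (j : ℕ) (a : Option ℤ) :
    spinAtPer x (x.length + j) a = spinAtPer x j a := by
  cases a with
  | none => rfl
  | some l =>
    simp only [spinAtPer, Nat.cast_add, add_assoc, Int.add_emod_left]

/-- The energy contributed by position `j`, and `0` outside the configuration. -/
def localEnergyPer {q k p : ℕ} (h : Fin p → (Fin k → Option (Fin q)) → ℤ)
    (x : Config q k p) (j : ℕ) : ℤ :=
  (x[j]?).elim 0 fun e => h e.2.1 fun l => spinAtPer x j (e.2.2 l)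

theorem energyPer_eq_sum_range {q k p : ℕ} (h : Fin p → (Fin k → Option (Fin q)) → ℤ)
    (x : Config q k p) :
    energyPer h x = ∑ j ∈ Finset.range x.length, localEnergyPer h x j := by
  rw [Finset.sum_range]
  simp [energyPer, localEnergyPer]

theorem energyPer_append_self {q k p : ℕ} (h : Fin p → (Fin k → Option (Fin q)) → ℤ)
    (x : Config q k p) (hx : x ≠ []) : energyPer h (x ++ x) = 2 * energyPer h x := by
  rw [energyPer_eq_sum_range, energyPer_eq_sum_range, List.length_append,
    Finset.sum_range_add, two_mul]
  congr 1 <;> refine Finset.sum_congr rfl fun j hj => ?_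
  · simp only [localEnergyPer, spinAtPer_append_self x hx,
      List.getElem?_append_left (Finset.mem_range.mp hj)]
  · simp only [localEnergyPer, spinAtPer_append_self x hx, spinAtPer_length_add,
      List.getElem?_append_right (Nat.le_add_right _ _), Nat.add_sub_cancel_left]

theorem append_self_mem_Domain1D {q k p : ℕ} {S : Set (LocInt k p)} {x : Config q k p}
    (hx : x ∈ Domain1D q S) : x ++ x ∈ Domain1D q S := by
  have hmem : ∀ y : Config q k p, (∀ j : Fin y.length, (y.get j).2 ∈ S) ↔ ∀ e ∈ y, e.2 ∈ S :=
    fun y => (List.forall_mem_iff_get (p := fun e : Fin q × LocInt k p => e.2 ∈ S)).symm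
  obtain ⟨hne, hS⟩ := hx
  rw [hmem] at hS
  refine ⟨by simp [hne], (hmem _).mpr fun e he => hS e ?_⟩
  simpa using he

/-- A 1D spin Hamiltonian with periodic boundary conditions and bounded
image is identically zero on its domain; the key step is `H(x²) = 2·H(x)` for the
doubled configuration `x² = x ++ x`. -/
theorem periodic_bounded_zero {q k p : ℕ} (hq : 0 < q) (hk : 0 < k) (hp : 0 < p)
    (h : Fin p → (Fin k → Option (Fin q)) → ℤ)
    (S : Set (LocInt k p)) (hS : Is1DIntSet S)
    (hbdd : ∃ B : ℤ, ∀ x ∈ Domain1D q S, |energyPer h x| ≤ B) :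
    (∀ x ∈ Domain1D q S, energyPer h (x ++ x) = 2 * energyPer h x) ∧
      (∀ x ∈ Domain1D q S, energyPer h x = 0) := by
  have hdouble : ∀ x ∈ Domain1D q S, energyPer h (x ++ x) = 2 * energyPer h x :=
    fun x hx => energyPer_append_self h x hx.1
  refine ⟨hdouble, ?_⟩
  obtain ⟨B, hB⟩ := hbdd
  have hpow : ∀ m : ℕ, ∀ x ∈ Domain1D q S, 2 ^ m * |energyPer h x| ≤ B := by
    intro m
    induction m with
    | zero => simpa using hB
    | succ m ih =>
      intro x hx
      have := ih _ (append_self_mem_Domain1D hx)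
      rw [hdouble x hx, abs_mul, abs_two] at this
      rwa [pow_succ, mul_assoc]
  intro x hx
  by_contra hne
  have hpos : 1 ≤ |energyPer h x| := Int.one_le_abs hne
  have hlt : (B.toNat : ℤ) < 2 ^ B.toNat := by exact_mod_cast Nat.lt_two_pow_self
  have hle : (2 : ℤ) ^ B.toNat ≤ B :=
    (le_mul_of_one_le_right (by positivity) hpos).trans (hpow B.toNat x hx)
  omega
end
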